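/- Fix integers p, q ≥ 0, set n := p + q and N := n + 2, and let ε_A = 1 for the first p+1 coordinate indices of ℝ^N and ε_A = −1 for the last q+1. Define r(x) := ½ Σ_A ε_A x_A² and, for a C² function g on an open subset of ℝ^N, Δg := Σ_A ε_A ∂²g/∂x_A². Let w ∈ ℝ and let f be a C² function on ℝ^N ∖ {0} with f(s • x) = s^w f(x) for all s > 0 and x ≠ 0. Then for every index A and every x ≠ 0: (n + 2w + 2)·∂_A(r·f)(x) − ε_A x_A · Δ(r·f)(x) = r(x) · ( (n + 2w + 2)·∂_A f(x) − ε_A x_A · Δf(x) ). In particular, the left-hand side vanishes at every nonzero null point x (i.e. whenever r(x) = 0). -/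

import Mathlib

noncomputable section

/-- The signs `ε_A`: `+1` for the first `p+1` coordinates of `ℝ^{n+2}`, `−1` for the
last `q+1`. -/
def eps (p q : ℕ) (A : Fin (p + q + 2)) : ℝ := if (A : ℕ) < p + 1 then 1 else -1

/-- `r(x) := ½ Σ_A ε_A x_A²`. -/
def rfun (p q : ℕ) (x : Fin (p + q + 2) → ℝ) : ℝ :=
  (1 / 2) * ∑ A, eps p q A * x A ^ 2

/-- The partial derivative `∂g/∂x_A`. -/
def pderiv (N : ℕ) (A : Fin N) (g : (Fin N → ℝ) → ℝ) : (Fin N → ℝ) → ℝ :=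
  fun x => fderiv ℝ g x (Pi.single A 1)

/-- The flat ambient Laplacian `Δg = Σ_A ε_A ∂²g/∂x_A²` of signature `(p+1, q+1)`. -/
def lap (p q : ℕ) (g : (Fin (p + q + 2) → ℝ) → ℝ) : (Fin (p + q + 2) → ℝ) → ℝ :=
  fun x => ∑ A, eps p q A * pderiv _ A (pderiv _ A g) x

lemma eps_mul_self (p q : ℕ) (A : Fin (p + q + 2)) : eps p q A * eps p q A = 1 := by
  unfold eps; split_ifs <;> norm_num

lemma differentiable_rfun (p q : ℕ) : Differentiable ℝ (rfun p q) := by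
  unfold rfun; fun_prop

lemma pderiv_mul {N : ℕ} {g h : (Fin N → ℝ) → ℝ} {x : Fin N → ℝ} (A : Fin N)
    (hg : DifferentiableAt ℝ g x) (hh : DifferentiableAt ℝ h x) :
    pderiv N A (fun y => g y * h y) x = pderiv N A g x * h x + g x * pderiv N A h x := by
  simp only [pderiv, fderiv_fun_mul hg hh]
  simp
  ring

lemma pderiv_const_mul_coord {N : ℕ} (c : ℝ) (A : Fin N) (x : Fin N → ℝ) :
    pderiv N A (fun y => c * y A) x = c := by
  have h : HasFDerivAt (fun y : Fin N → ℝ => c * y A)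
      (c • ContinuousLinearMap.proj (R := ℝ) (φ := fun _ : Fin N => ℝ) A) x :=
    (hasFDerivAt_apply A x).const_mul c
  simp [pderiv, h.fderiv]

lemma pderiv_rfun (p q : ℕ) (A : Fin (p + q + 2)) (x : Fin (p + q + 2) → ℝ) :
    pderiv _ A (rfun p q) x = eps p q A * x A := by
  have h : HasFDerivAt (rfun p q) ((1 / 2 : ℝ) • ∑ B, eps p q B •
      ((2 * x B) • ContinuousLinearMap.proj (R := ℝ) (φ := fun _ : Fin (p + q + 2) => ℝ) B)) x := by
    refine HasFDerivAt.const_mul (HasFDerivAt.fun_sum fun B _ => HasFDerivAt.const_mul ?_ _) _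
    simpa using (hasFDerivAt_apply (𝕜 := ℝ) B x).pow 2
  simp [pderiv, h.fderiv, Pi.single_apply]
  ring

lemma pderiv_rfun_mul {p q : ℕ} {f : (Fin (p + q + 2) → ℝ) → ℝ} {x : Fin (p + q + 2) → ℝ}
    (hf : DifferentiableAt ℝ f x) (A : Fin (p + q + 2)) :
    pderiv _ A (fun y => rfun p q y * f y) x
      = eps p q A * x A * f x + rfun p q x * pderiv _ A f x := by
  rw [pderiv_mul A (differentiable_rfun p q x) hf, pderiv_rfun]

lemma differentiableAt_pderiv {N : ℕ} {f : (Fin N → ℝ) → ℝ} {x : Fin N → ℝ}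
    (hf : ContDiffAt ℝ 2 f x) (A : Fin N) : DifferentiableAt ℝ (pderiv N A f) x :=
  ((hf.fderiv_right (m := 1) (by norm_num)).differentiableAt (by norm_num)).clm_apply
    (differentiableAt_const _)

lemma pderiv_pderiv_rfun_mul {p q : ℕ} {f : (Fin (p + q + 2) → ℝ) → ℝ}
    {x : Fin (p + q + 2) → ℝ} (hf : ContDiffAt ℝ 2 f x) (A : Fin (p + q + 2)) :
    pderiv _ A (pderiv _ A (fun y => rfun p q y * f y)) x
      = eps p q A * f x + 2 * (eps p q A * x A * pderiv _ A f x)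
        + rfun p q x * pderiv _ A (pderiv _ A f) x := by
  have hev : pderiv _ A (fun y => rfun p q y * f y) =ᶠ[nhds x]
      fun y => eps p q A * y A * f y + rfun p q y * pderiv _ A f y := by
    filter_upwards [hf.eventually (by simp)] with y hy
    exact pderiv_rfun_mul (hy.differentiableAt (by norm_num)) A
  have hfx := hf.differentiableAt (by norm_num)
  have hd := differentiableAt_pderiv hf A
  have hc : DifferentiableAt ℝ (fun y : Fin (p + q + 2) → ℝ => eps p q A * y A) x := by fun_prop
  have hadd : pderiv _ A (pderiv _ A (fun y => rfun p q y * f y)) x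
      = pderiv _ A (fun y => eps p q A * y A * f y) x
        + pderiv _ A (fun y => rfun p q y * pderiv _ A f y) x := by
    rw [pderiv, hev.fderiv_eq,
      fderiv_fun_add (hc.fun_mul hfx) ((differentiable_rfun p q x).fun_mul hd)]
    rfl
  rw [hadd, pderiv_mul A hc hfx, pderiv_rfun_mul hd, pderiv_const_mul_coord]
  ring

/-- Euler's identity for positively homogeneous functions. -/
lemma sum_mul_pderiv_of_homogeneous {N : ℕ} {w : ℝ} {f : (Fin N → ℝ) → ℝ} {x : Fin N → ℝ}
    (hf : DifferentiableAt ℝ f x) (hhom : ∀ s : ℝ, 0 < s → f (s • x) = s ^ w * f x) :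
    ∑ A, x A * pderiv N A f x = w * f x := by
  have h1 : HasDerivAt (fun s : ℝ => f (s • x)) (fderiv ℝ f x x) 1 := by
    have hs : HasDerivAt (fun s : ℝ => s • x) x 1 := by
      simpa using (hasDerivAt_id (1 : ℝ)).smul_const x
    have hf' : HasFDerivAt f (fderiv ℝ f x) ((1 : ℝ) • x) := by simpa using hf.hasFDerivAt
    exact hf'.comp_hasDerivAt 1 hs
  have h2 : HasDerivAt (fun s : ℝ => f (s • x)) (w * f x) 1 := by
    have h := (Real.hasDerivAt_rpow_const (x := 1) (p := w) (Or.inl one_ne_zero)).mul_const (f x)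
    rw [Real.one_rpow, mul_one] at h
    refine h.congr_of_eventuallyEq ?_
    filter_upwards [lt_mem_nhds one_pos] with s hs using hhom s hs
  rw [← h1.unique h2]
  conv_rhs => arg 2; rw [pi_eq_sum_univ' x]
  rw [map_sum]
  refine Finset.sum_congr rfl fun A _ => ?_
  rw [map_smul, smul_eq_mul, pderiv]

lemma lap_rfun_mul {p q : ℕ} {w : ℝ} {f : (Fin (p + q + 2) → ℝ) → ℝ}
    {x : Fin (p + q + 2) → ℝ} (hf : ContDiffAt ℝ 2 f x)
    (hhom : ∀ s : ℝ, 0 < s → f (s • x) = s ^ w * f x) :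
    lap p q (fun y => rfun p q y * f y) x
      = ((p + q : ℝ) + 2 * w + 2) * f x + rfun p q x * lap p q f x := by
  have hterm : ∀ A, eps p q A * pderiv _ A (pderiv _ A (fun y => rfun p q y * f y)) x
      = f x + 2 * (x A * pderiv _ A f x)
        + rfun p q x * (eps p q A * pderiv _ A (pderiv _ A f) x) := fun A => by
    rw [pderiv_pderiv_rfun_mul hf]
    linear_combination (f x + 2 * (x A * pderiv _ A f x)) * eps_mul_self p q A
  simp only [lap, hterm, Finset.sum_add_distrib, ← Finset.mul_sum,
    sum_mul_pderiv_of_homogeneous (hf.differentiableAt (by norm_num)) hhom]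
  simp
  ring

/-- For a `C²` function `f` on `ℝ^{n+2} ∖ {0}` homogeneous of degree `w`, the tractor
`D`-operator applied to `r·f` satisfies
`(n + 2w + 2)·∂_A(r·f) − ε_A x_A·Δ(r·f) = r·((n + 2w + 2)·∂_A f − ε_A x_A·Δf)`;
in particular the left-hand side vanishes at every nonzero null point. -/
theorem tractorD_acts_tangentially (p q : ℕ) (w : ℝ)
    (f : (Fin (p + q + 2) → ℝ) → ℝ)
    (hf : ContDiffOn ℝ 2 f {x : Fin (p + q + 2) → ℝ | x ≠ 0})
    (hhom : ∀ s : ℝ, 0 < s → ∀ x : Fin (p + q + 2) → ℝ, x ≠ 0 →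
      f (s • x) = s ^ w * f x) :
    ∀ (A : Fin (p + q + 2)) (x : Fin (p + q + 2) → ℝ), x ≠ 0 →
      (((p + q : ℝ) + 2 * w + 2) * pderiv _ A (fun y => rfun p q y * f y) x
          - eps p q A * x A * lap p q (fun y => rfun p q y * f y) x
        = rfun p q x *
            (((p + q : ℝ) + 2 * w + 2) * pderiv _ A f x
              - eps p q A * x A * lap p q f x)) ∧
      (rfun p q x = 0 →
        ((p + q : ℝ) + 2 * w + 2) * pderiv _ A (fun y => rfun p q y * f y) x
          - eps p q A * x A * lap p q (fun y => rfun p q y * f y) x = 0) := by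
  intro A x hx
  have hfx : ContDiffAt ℝ 2 f x := hf.contDiffAt (isOpen_ne.mem_nhds hx)
  have key : ((p + q : ℝ) + 2 * w + 2) * pderiv _ A (fun y => rfun p q y * f y) x
      - eps p q A * x A * lap p q (fun y => rfun p q y * f y) x
        = rfun p q x * (((p + q : ℝ) + 2 * w + 2) * pderiv _ A f x
            - eps p q A * x A * lap p q f x) := by
    rw [pderiv_rfun_mul (hfx.differentiableAt (by norm_num)),
      lap_rfun_mul hfx fun s hs => hhom s hs x hx]
    ring
  exact ⟨key, fun hr => by rw [key, hr, zero_mul]⟩
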